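/- Let R be a Noetherian commutative ring, and let J' ⊆ J and K' ⊆ K be ideals such that J' is a reduction of J and K' is a reduction of K. Then J'K' is a reduction of JK; that is, JK is integral over J'K'. -/

import Mathlib

/-- `J'` is a reduction of `J` if `J' ⊆ J` and `J' J^n = J^{n+1}` for some `n ≥ 0`;
equivalently (in a Noetherian ring), `J` is integral over `J'`. -/
def IsIdealReduction {R : Type*} [CommRing R] (J' J : Ideal R) : Prop :=
  J' ≤ J ∧ ∃ n : ℕ, J' * J ^ n = J ^ (n + 1)

/-- Once `J' J^n = J^{n+1}`, the same holds for every larger exponent. -/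
theorem Ideal.mul_pow_add_eq_of_mul_pow_eq {R : Type*} [CommRing R] {J' J : Ideal R} {n : ℕ}
    (h : J' * J ^ n = J ^ (n + 1)) (k : ℕ) : J' * J ^ (n + k) = J ^ (n + k + 1) := by
  rw [pow_add, ← mul_assoc, h, ← pow_add, Nat.add_right_comm]

/-- If `J'` is a reduction of `J` and `K'` is a reduction of `K` in a Noetherian commutative
ring, then `J'K'` is a reduction of `JK`. -/
theorem isIdealReduction_mul
    (R : Type*) [CommRing R] [IsNoetherianRing R]
    (J' J K' K : Ideal R)
    (hJ : IsIdealReduction J' J) (hK : IsIdealReduction K' K) :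
    IsIdealReduction (J' * K') (J * K) := by
  obtain ⟨hJ, n, hn⟩ := hJ
  obtain ⟨hK, m, hm⟩ := hK
  refine ⟨Ideal.mul_mono hJ hK, n + m, ?_⟩
  rw [mul_pow, mul_pow, mul_mul_mul_comm, Ideal.mul_pow_add_eq_of_mul_pow_eq hn,
    add_comm n m, Ideal.mul_pow_add_eq_of_mul_pow_eq hm]
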